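/- arXiv:2211.08729 — 3 statements merged into one kernel-verified Lean document; each statement's English description precedes it below -/
import Mathlib

section
/- Let K ⊆ ℂ be a subfield, let Q₀ ∈ K^×, and suppose (A₁,B₁), (A₂,B₂) ∈ W_N^{top,0}(K) both have λ-invariant Q₀. If g ∈ (SL_n × SL_{n+1})(K) satisfies g·(A₁,B₁) = (A₂,B₂), then g ∈ L_N(K). -/
open Matrix MvPolynomial

/-- Pairs of `N × N` matrices over `R`, with `N = 2n+1`. -/
abbrev MPair (n : ℕ) (R : Type*) : Type _ :=
  Matrix (Fin (2*n+1)) (Fin (2*n+1)) R × Matrix (Fin (2*n+1)) (Fin (2*n+1)) R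

/-- The action of a matrix `g` on a pair: `g • (A, B) = (g A gᵀ, g B gᵀ)`. -/
def actPair {R : Type*} [CommRing R] {m : ℕ} (g : Matrix (Fin m) (Fin m) R)
    (w : Matrix (Fin m) (Fin m) R × Matrix (Fin m) (Fin m) R) :
    Matrix (Fin m) (Fin m) R × Matrix (Fin m) (Fin m) R :=
  (g * w.1 * g.transpose, g * w.2 * g.transpose)

/-- Membership in `W_N(R)`: both matrices are symmetric. -/
def WNmem {R : Type*} [CommRing R] (n : ℕ) (w : MPair n R) : Prop := w.1.IsSymm ∧ w.2.IsSymm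

/-- The inclusion `Fin n → Fin (2n+1)` of the first `n` indices. -/
def rowIdx (n : ℕ) (i : Fin n) : Fin (2*n+1) := Fin.castLE (by omega) i

/-- The inclusion `Fin (n+1) → Fin (2n+1)` of the last `n+1` indices. -/
def colIdx (n : ℕ) (j : Fin (n+1)) : Fin (2*n+1) :=
  Fin.cast (by omega) (Fin.natAdd n j)

/-- The coefficient of `x^{N-i} y^i` in a binary `N`-ic form (written in
`MvPolynomial (Fin 2) R`, where variable `0` is `x` and variable `1` is `y`). -/
noncomputable def formCoeff {R : Type*} [CommRing R] (f : MvPolynomial (Fin 2) R) (N i : ℕ) : R :=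
  MvPolynomial.coeff (Finsupp.single (0 : Fin 2) (N - i) + Finsupp.single (1 : Fin 2) i) f

/-- The `λ`-invariant of a pair `(A,B)`, computed from the top-right `n × (n+1)` blocks:
the determinant of the `(n+1) × (n+1)` matrix whose `(i,j)` entry (0-indexed) is `(-1)^i`
times the coefficient of `x^{n-j} y^j` in `det(x A^{(i)} - y B^{(i)})`, where `A^{(i)}`,
`B^{(i)}` are obtained from the top-right `n × (n+1)` blocks by deleting the `i`-th column. -/
noncomputable def lambdaInv {R : Type*} [CommRing R] (n : ℕ) (w : MPair n R) : R :=
  Matrix.det (Matrix.of fun i j : Fin (n+1) =>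
    (-1 : R) ^ (i : ℕ) *
      formCoeff
        (Matrix.det (Matrix.of fun r c : Fin n =>
          MvPolynomial.X 0 * MvPolynomial.C (w.1 (rowIdx n r) (colIdx n (i.succAbove c))) -
          MvPolynomial.X 1 * MvPolynomial.C (w.2 (rowIdx n r) (colIdx n (i.succAbove c)))))
        n (j : ℕ))
/-- Membership in `W_N^top(R)`: symmetric pairs vanishing on the top-left `n × n` and
bottom-right `(n+1) × (n+1)` blocks. -/
def Wtopmem {R : Type*} [CommRing R] (n : ℕ) (w : MPair n R) : Prop :=
  WNmem n w ∧ ∀ i j : Fin (2*n+1),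
    (((i : ℕ) < n ∧ (j : ℕ) < n) ∨ (n ≤ (i : ℕ) ∧ n ≤ (j : ℕ))) → w.1 i j = 0 ∧ w.2 i j = 0

/-- Membership in the block-diagonal subgroup `(SL_n × SL_{n+1})(R) ⊆ SL_N(R)`. -/
def SLnn1mem {R : Type*} [CommRing R] (n : ℕ) (g : Matrix (Fin (2*n+1)) (Fin (2*n+1)) R) :
    Prop :=
  (∀ i j : Fin (2*n+1),
      (((i : ℕ) < n ∧ n ≤ (j : ℕ)) ∨ (n ≤ (i : ℕ) ∧ (j : ℕ) < n)) → g i j = 0) ∧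
  Matrix.det (Matrix.of fun i j : Fin n => g (rowIdx n i) (rowIdx n j)) = 1 ∧
  Matrix.det (Matrix.of fun i j : Fin (n+1) => g (colIdx n i) (colIdx n j)) = 1
/-- Membership in `W_N^{top,0}(R)`: elements of `W_N^top(R)` with (1-indexed) `A_{ij} = 0`
for `i + j ≤ 2n+1` and `B_{ij} = 0` for `i + j ≤ 2n`. -/
def Wtop0mem {R : Type*} [CommRing R] (n : ℕ) (w : MPair n R) : Prop :=
  Wtopmem n w ∧ ∀ i j : Fin (2*n+1),
    (((i : ℕ) + 1) + ((j : ℕ) + 1) ≤ 2*n+1 → w.1 i j = 0) ∧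
    (((i : ℕ) + 1) + ((j : ℕ) + 1) ≤ 2*n → w.2 i j = 0)

/-- Membership in the lower-triangular subgroup `L_N(R) ⊆ (SL_n × SL_{n+1})(R)`. -/
def LNmem {R : Type*} [CommRing R] (n : ℕ) (g : Matrix (Fin (2*n+1)) (Fin (2*n+1)) R) : Prop :=
  SLnn1mem n g ∧ ∀ i j : Fin (2*n+1), (i : ℕ) < (j : ℕ) → g i j = 0

/-- A matrix pencil `x A - y B` bordered on top by a constant row `u` is nonsingular as soon as
the coefficient matrix of its signed maximal minors is nonsingular. -/
theorem det_cons_pencil_ne_zero {K : Type*} [Field K] {n : ℕ}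
    (M : Fin n → Fin (n+1) → MvPolynomial (Fin 2) K)
    (hM : Matrix.det (Matrix.of fun i j : Fin (n+1) => (-1 : K) ^ (i : ℕ) *
      formCoeff (Matrix.det (Matrix.of fun r c : Fin n => M r (i.succAbove c))) n (j : ℕ)) ≠ 0)
    {u : Fin (n+1) → K} (hu : u ≠ 0) :
    Matrix.det (Matrix.of (Fin.cons (fun c => MvPolynomial.C (u c)) M :
      Fin (n+1) → Fin (n+1) → MvPolynomial (Fin 2) K)) ≠ 0 := by
  intro h
  apply hM
  rw [← Matrix.exists_vecMul_eq_zero_iff]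
  refine ⟨u, hu, ?_⟩
  ext j
  rw [Matrix.det_succ_row_zero] at h
  have h2 := congrArg (fun f => formCoeff f n (j : ℕ)) h
  simp only [formCoeff, MvPolynomial.coeff_sum, MvPolynomial.coeff_zero] at h2
  rw [Matrix.vecMul, dotProduct, Pi.zero_apply, ← h2]
  refine Finset.sum_congr rfl fun i _ => ?_
  have e : (-1 : MvPolynomial (Fin 2) K) ^ (i : ℕ) = MvPolynomial.C ((-1) ^ (i : ℕ)) := by simp
  have e2 : ((Matrix.of (Fin.cons (fun c => MvPolynomial.C (u c)) M :
      Fin (n+1) → Fin (n+1) → MvPolynomial (Fin 2) K)).submatrix Fin.succ i.succAbove) =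
      Matrix.of fun r c : Fin n => M r (i.succAbove c) := by
    ext r c
    simp
  rw [e2, e]
  simp only [Matrix.of_apply, Fin.cons_zero, formCoeff]
  rw [← map_mul, MvPolynomial.coeff_C_mul]
  ring

/-- Block-triangular pencils with nonvanishing `λ`-invariant have nonzero extreme entries. -/
theorem pencil_extreme_entries_ne_zero {K : Type*} [Field K] {n : ℕ}
    (A B : Matrix (Fin n) (Fin (n+1)) K)
    (hA : ∀ (r : Fin n) (c : Fin (n+1)), (r : ℕ) + c < n → A r c = 0) (hB : ∀ (r : Fin n) (c : Fin (n+1)), (r : ℕ) + c + 1 < n → B r c = 0)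
    (hl : Matrix.det (Matrix.of fun i j : Fin (n+1) => (-1 : K) ^ (i : ℕ) *
      formCoeff (Matrix.det (Matrix.of fun r c : Fin n =>
        MvPolynomial.X 0 * MvPolynomial.C (A r (i.succAbove c)) -
        MvPolynomial.X 1 * MvPolynomial.C (B r (i.succAbove c)))) n (j : ℕ)) ≠ 0) (r : Fin n) :
    A r r.castSucc.rev ≠ 0 ∧ B r r.succ.rev ≠ 0 := by
  have key := fun u hu => det_cons_pencil_ne_zero (fun r c =>
        MvPolynomial.X 0 * MvPolynomial.C (A r c) -
        MvPolynomial.X 1 * MvPolynomial.C (B r c)) hl (u := u) hu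
  constructor
  · intro hr
    have hdet : Matrix.det (A.submatrix id fun s : Fin n => s.castSucc.rev) = 0 := by
      rw [Matrix.det_of_isLowerTriangular]
      · exact Finset.prod_eq_zero (Finset.mem_univ r) hr
      · intro i j hij
        have hij : (i : ℕ) < j := hij
        refine hA _ _ ?_
        simp [Fin.val_rev]
        omega
    rw [← Matrix.exists_vecMul_eq_zero_iff] at hdet
    obtain ⟨v, hv, hvA⟩ := hdet
    have hvA' : ∀ c, ∑ i, v i * A i c = 0 := by
      intro c
      by_cases hc : c = 0
      · subst hc
        refine Finset.sum_eq_zero fun i _ => ?_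
        rw [hA i 0 (by simp), mul_zero]
      · obtain ⟨d, hd⟩ : ∃ d : Fin n, c = d.castSucc.rev := by
          have h0 : (c : ℕ) ≠ 0 := fun h => hc (Fin.ext h)
          refine ⟨⟨n - c, by omega⟩, ?_⟩
          ext
          simp [Fin.val_rev]
          omega
        subst hd
        exact congrFun hvA d
    obtain ⟨i₀, hi₀⟩ := Function.ne_iff.mp hv
    have hvM : ∀ c, ∑ i, MvPolynomial.C (v i) * (MvPolynomial.X 0 * MvPolynomial.C (A i c) -
        MvPolynomial.X 1 * MvPolynomial.C (B i c)) =
        -(MvPolynomial.X (1 : Fin 2) * MvPolynomial.C ((v ᵥ* B) c)) := by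
      intro c
      have e : ∀ i, MvPolynomial.C (v i) * (MvPolynomial.X 0 * MvPolynomial.C (A i c) -
          MvPolynomial.X 1 * MvPolynomial.C (B i c)) =
          MvPolynomial.X (0 : Fin 2) * MvPolynomial.C (v i * A i c) -
          MvPolynomial.X 1 * MvPolynomial.C (v i * B i c) := by
        intro i; rw [map_mul, map_mul]; ring
      simp only [e]
      rw [Finset.sum_sub_distrib, ← Finset.mul_sum, ← Finset.mul_sum, ← map_sum, ← map_sum,
        hvA', map_zero, mul_zero, zero_sub]
      rfl
    by_cases hvB : v ᵥ* B = 0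
    · refine key (fun _ => 1) (Function.ne_iff.mpr ⟨0, one_ne_zero⟩) ?_
      rw [← Matrix.exists_vecMul_eq_zero_iff]
      refine ⟨Fin.cons 0 fun i => MvPolynomial.C (v i), ?_, ?_⟩
      · exact Function.ne_iff.mpr ⟨i₀.succ, by simpa using hi₀⟩
      · ext1 c
        simp only [Matrix.vecMul, dotProduct, Fin.sum_univ_succ, Matrix.of_apply, Fin.cons_zero,
          Fin.cons_succ, Pi.zero_apply, zero_mul, zero_add]
        rw [hvM, hvB]
        simp
    · refine key (v ᵥ* B) hvB ?_
      rw [← Matrix.exists_vecMul_eq_zero_iff]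
      refine ⟨Fin.cons (MvPolynomial.X 1) fun i => MvPolynomial.C (v i), ?_, ?_⟩
      · exact Function.ne_iff.mpr ⟨i₀.succ, by simpa using hi₀⟩
      · ext1 c
        rw [Matrix.vecMul, dotProduct, Fin.sum_univ_succ]
        simp only [Matrix.of_apply, Fin.cons_zero, Fin.cons_succ, Pi.zero_apply]
        rw [hvM, add_neg_cancel]
  · intro hr
    refine key (Pi.single (Fin.last n) 1) (by simp) ?_
    have hp := Matrix.det_permute' (Fin.revPerm (n := n+1)) (Matrix.of (Fin.cons
      (fun c => MvPolynomial.C ((Pi.single (Fin.last n) 1 : Fin (n+1) → K) c))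
      (fun r c => MvPolynomial.X 0 * MvPolynomial.C (A r c) -
        MvPolynomial.X 1 * MvPolynomial.C (B r c)) :
      Fin (n+1) → Fin (n+1) → MvPolynomial (Fin 2) K))
    rw [Matrix.det_of_isLowerTriangular] at hp
    · rw [Finset.prod_eq_zero (Finset.mem_univ r.succ)] at hp
      · rcases mul_eq_zero.mp hp.symm with h | h
        · rcases Int.units_eq_one_or (Equiv.Perm.sign (Fin.revPerm (n := n+1))) with h' | h' <;>
            simp [h'] at h
        · exact h
      · have hAr : A r r.succ.rev = 0 := hA _ _ (by simp [Fin.val_rev]; omega)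
        simp only [Matrix.submatrix_apply, id_eq, Matrix.of_apply, Fin.cons_succ,
          Fin.revPerm_apply, hAr, hr]
        simp
    · intro i j hij
      have hij : i < j := hij
      refine Fin.cases ?_ (fun i => ?_) i hij
      · intro h0
        have : j.rev ≠ Fin.last n := by
          intro h
          have h1 := congrArg Fin.val h
          have h0 : 0 < (j : ℕ) := h0
          simp [Fin.val_rev] at h1
          omega
        simp [Pi.single_eq_of_ne this]
      · intro h
        have h : (i : ℕ) + 1 < j := by simpa [Fin.lt_def] using h
        have hAr : A i j.rev = 0 := hA _ _ (by simp [Fin.val_rev]; omega)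
        have hBr : B i j.rev = 0 := hB _ _ (by simp [Fin.val_rev]; omega)
        simp [hAr, hBr]

/-- Intertwiners of lower triangular pencils with nonzero extreme entries are lower triangular:
they preserve the flags defined from the pencils by alternating images under `a` and preimages
under `b`. -/
theorem lowerTriangular_of_intertwines {K : Type*} [Field K] {n : ℕ}
    (a b a' b' : Matrix (Fin n) (Fin (n+1)) K) (g : Matrix (Fin n) (Fin n) K)
    (p : Matrix (Fin (n+1)) (Fin (n+1)) K)
    (ha : ∀ (r : Fin n) (c : Fin (n+1)), (r : ℕ) < c → a r c = 0) (hb : ∀ (r : Fin n) (c : Fin (n+1)), (r : ℕ) + 1 < c → b r c = 0)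
    (ha' : ∀ (r : Fin n) (c : Fin (n+1)), (r : ℕ) < c → a' r c = 0) (hb' : ∀ (r : Fin n) (c : Fin (n+1)), (r : ℕ) + 1 < c → b' r c = 0)
    (had : ∀ r : Fin n, a' r r.castSucc ≠ 0) (hbd : ∀ r : Fin n, b r r.succ ≠ 0)
    (h1 : a' * p = g * a) (h2 : b' * p = g * b) :
    (∀ r s, r < s → g r s = 0) ∧ (∀ c d, c < d → p c d = 0) := by
  have image_step : ∀ k : ℕ, k ≤ n → (∀ r s : Fin n, (r : ℕ) < k → k ≤ (s : ℕ) → g r s = 0) →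
      ∀ c d : Fin (n+1), (c : ℕ) < k → k ≤ (d : ℕ) → p c d = 0 := by
    intro k hk hP c d hc hd
    obtain ⟨m, hm⟩ : ∃ m, (c : ℕ) = m := ⟨_, rfl⟩
    induction m using Nat.strong_induction_on generalizing c with
    | _ m ih =>
      have hcn : (c : ℕ) < n := by omega
      have e := congrFun (congrFun h1 ⟨c, hcn⟩) d
      rw [Matrix.mul_apply, Matrix.mul_apply] at e
      have hr : ∑ s, g ⟨c, hcn⟩ s * a s d = 0 := by
        refine Finset.sum_eq_zero fun s _ => ?_
        by_cases hs : k ≤ (s : ℕ)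
        · rw [hP _ s hc hs, zero_mul]
        · rw [ha s d (by omega), mul_zero]
      rw [hr, Finset.sum_eq_single c] at e
      · exact (mul_eq_zero.mp e).resolve_left (show a' ⟨c, hcn⟩ c ≠ 0 from had ⟨c, hcn⟩)
      · intro c' _ hne
        rcases lt_or_gt_of_ne (Fin.val_ne_of_ne hne) with h | h
        · rw [ih c' (by omega) c' (by omega) rfl, mul_zero]
        · rw [ha' _ _ h, zero_mul]
      · simp
  have preimage_step : ∀ k : ℕ, k < n →
      (∀ c d : Fin (n+1), (c : ℕ) < k + 1 → k + 1 ≤ (d : ℕ) → p c d = 0) →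
      ∀ r s : Fin n, (r : ℕ) < k → k ≤ (s : ℕ) → g r s = 0 := by
    intro k hk hQ r s hr hs
    obtain ⟨m, hm⟩ : ∃ m, n - (s : ℕ) = m := ⟨_, rfl⟩
    induction m using Nat.strong_induction_on generalizing s with
    | _ m ih =>
      have e := congrFun (congrFun h2 r) s.succ
      rw [Matrix.mul_apply, Matrix.mul_apply] at e
      have hl : ∑ c, b' r c * p c s.succ = 0 := by
        refine Finset.sum_eq_zero fun c _ => ?_
        by_cases hc : (c : ℕ) < k + 1
        · rw [hQ c _ hc (by simpa using hs), mul_zero]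
        · rw [hb' r c (by omega), zero_mul]
      rw [hl, Finset.sum_eq_single s] at e
      · exact (mul_eq_zero.mp e.symm).resolve_right (hbd s)
      · intro t _ hne
        rcases lt_or_gt_of_ne (Fin.val_ne_of_ne hne) with h | h
        · rw [hb t _ (by simpa using h), mul_zero]
        · rw [ih (n - t) (by omega) t (by omega) rfl, zero_mul]
      · simp
  have flag : ∀ m k : ℕ, k + m = n → ∀ r s : Fin n, (r : ℕ) < k → k ≤ (s : ℕ) → g r s = 0 := by
    intro m
    induction m with
    | zero => intro k hk r s _ hs; omega
    | succ m ih =>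
      intro k hk
      exact preimage_step k (by omega) (image_step (k + 1) (by omega) (ih (k + 1) (by omega)))
  refine ⟨fun r s hrs => ?_, fun c d hcd => ?_⟩
  · exact flag (n - s) s (by omega) r s hrs le_rfl
  · exact image_step d (by omega) (flag (n - d) d (by omega)) c d hcd le_rfl

/-- A sum over `Fin (2n+1)` splits into the first `n` and the last `n+1` indices. -/
theorem sum_rowIdx_add_sum_colIdx {M : Type*} [AddCommMonoid M] (n : ℕ) (f : Fin (2*n+1) → M) :
    ∑ i, f i = ∑ i, f (rowIdx n i) + ∑ j, f (colIdx n j) := by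
  have h : n + (n + 1) = 2 * n + 1 := by omega
  rw [← Equiv.sum_comp (finCongr h) f, Fin.sum_univ_add]
  rfl

/-- The top-right block of `g A gᵀ` for block-diagonal `g`. -/
theorem topRight_mul_mul_transpose {R : Type*} [CommRing R] (n : ℕ)
    (g A : Matrix (Fin (2*n+1)) (Fin (2*n+1)) R) (hg : SLnn1mem n g) :
    (g * A * g.transpose).submatrix (rowIdx n) (colIdx n) =
      g.submatrix (rowIdx n) (rowIdx n) * A.submatrix (rowIdx n) (colIdx n) *
        (g.submatrix (colIdx n) (colIdx n)).transpose := by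
  have hrc : ∀ r c, g (rowIdx n r) (colIdx n c) = 0 := fun r c =>
    hg.1 _ _ (Or.inl ⟨by simp [rowIdx], by simp [colIdx]⟩)
  have hcr : ∀ r c, g (colIdx n c) (rowIdx n r) = 0 := fun r c =>
    hg.1 _ _ (Or.inr ⟨by simp [colIdx], by simp [rowIdx]⟩)
  ext r c
  simp [Matrix.mul_apply, sum_rowIdx_add_sum_colIdx, hrc, hcr]

/-- The shape of the top-right blocks of an element of `W_N^{top,0}`, and the nonvanishing of
its extreme entries when the `λ`-invariant is nonzero. -/
theorem Wtop0mem.topRight {K : Type*} [Field K] {n : ℕ} {w : MPair n K} (hw : Wtop0mem n w)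
    (hl : lambdaInv n w ≠ 0) :
    (∀ (r : Fin n) (c : Fin (n+1)), (r : ℕ) < c → w.1 (rowIdx n r) (colIdx n c.rev) = 0) ∧
    (∀ (r : Fin n) (c : Fin (n+1)), (r : ℕ) + 1 < c → w.2 (rowIdx n r) (colIdx n c.rev) = 0) ∧
    ∀ r : Fin n, w.1 (rowIdx n r) (colIdx n r.castSucc.rev) ≠ 0 ∧
      w.2 (rowIdx n r) (colIdx n r.succ.rev) ≠ 0 := by
  refine ⟨fun r c h => (hw.2 _ _).1 ?_, fun r c h => (hw.2 _ _).2 ?_, fun r => ?_⟩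
  · simp [rowIdx, colIdx, Fin.val_rev]; omega
  · simp [rowIdx, colIdx, Fin.val_rev]; omega
  · refine pencil_extreme_entries_ne_zero (w.1.submatrix (rowIdx n) (colIdx n))
      (w.2.submatrix (rowIdx n) (colIdx n)) (fun r c h => (hw.2 _ _).1 ?_)
      (fun r c h => (hw.2 _ _).2 ?_) hl r
    · simp [rowIdx, colIdx]; omega
    · simp [rowIdx, colIdx]; omega

/-- **Equivalences between elements of `W_N^{top,0}` are implemented by `L_N`.**
Let `K ⊆ ℂ` be a subfield, `Q₀ ∈ K^×`, and let `(A₁,B₁), (A₂,B₂) ∈ W_N^{top,0}(K)` both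
have `λ`-invariant `Q₀`.  If `g ∈ (SL_n × SL_{n+1})(K)` carries `(A₁,B₁)` to `(A₂,B₂)`,
then `g ∈ L_N(K)`. -/
theorem mem_LN_of_equiv_in_Wtop0 (n : ℕ) (hn : 1 ≤ n) (K : Subfield ℂ)
    (Q₀ : K) (hQ₀ : Q₀ ≠ 0) (w w' : MPair n K)
    (hw : Wtop0mem n w) (hw' : Wtop0mem n w')
    (hl : lambdaInv n w = Q₀) (hl' : lambdaInv n w' = Q₀)
    (g : Matrix (Fin (2*n+1)) (Fin (2*n+1)) K)
    (hg : SLnn1mem n g) (hgw : actPair g w = w') :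
    LNmem n g := by
  subst hgw
  obtain ⟨ha, hb, hd⟩ := hw.topRight (hl ▸ hQ₀)
  obtain ⟨ha', hb', hd'⟩ := hw'.topRight (hl' ▸ hQ₀)
  set G := g.submatrix (rowIdx n) (rowIdx n) with hG
  set H := g.submatrix (colIdx n) (colIdx n) with hH
  have hdetH : IsUnit Hᵀ.det := by
    rw [Matrix.det_transpose, show H.det = 1 from hg.2.2]
    exact isUnit_one
  have intertwine : ∀ A : Matrix (Fin (2*n+1)) (Fin (2*n+1)) K,
      (g * A * gᵀ).submatrix (rowIdx n) (fun c => colIdx n c.rev) *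
        (Hᵀ⁻¹).submatrix Fin.rev Fin.rev =
      G * A.submatrix (rowIdx n) (fun c => colIdx n c.rev) := by
    intro A
    have e := topRight_mul_mul_transpose n g A hg
    calc _ = ((g * A * gᵀ).submatrix (rowIdx n) (colIdx n)).submatrix id Fin.revPerm *
          (Hᵀ⁻¹).submatrix Fin.revPerm Fin.rev := rfl
      _ = (G * A.submatrix (rowIdx n) (colIdx n) * Hᵀ * Hᵀ⁻¹).submatrix id Fin.rev := by
          rw [Matrix.submatrix_mul_equiv, e]
      _ = _ := by
          rw [Matrix.mul_nonsing_inv_cancel_right _ _ hdetH]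
          rfl
  obtain ⟨hGl, hPl⟩ := lowerTriangular_of_intertwines _ _ _ _ G _ ha hb ha' hb'
    (fun r => (hd' r).1) (fun r => (hd r).2) (intertwine w.1) (intertwine w.2)
  have hHl : ∀ c d, c < d → H c d = 0 := by
    have hinv : Invertible Hᵀ⁻¹ := Matrix.invertibleOfIsUnitDet _
      (Matrix.isUnit_nonsing_inv_det _ hdetH)
    have hP : Matrix.BlockTriangular Hᵀ⁻¹ id := by
      intro c d hdc
      have := hPl c.rev d.rev (Fin.rev_lt_rev.mpr hdc)
      simpa using this
    have := Matrix.blockTriangular_inv_of_blockTriangular hP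
    rw [Matrix.nonsing_inv_nonsing_inv _ hdetH] at this
    exact fun c d hcd => this hcd
  refine ⟨hg, fun i j hij => ?_⟩
  by_cases hi : (i : ℕ) < n <;> by_cases hj : (j : ℕ) < n
  · exact hGl ⟨i, hi⟩ ⟨j, hj⟩ hij
  · exact hg.1 i j (Or.inl ⟨hi, by omega⟩)
  · omega
  · have e : ∀ k : Fin (2*n+1), ¬ (k : ℕ) < n → ∀ h : (k : ℕ) - n < n + 1,
        colIdx n ⟨(k : ℕ) - n, h⟩ = k := by
      intro k hk h
      ext
      simp [colIdx]
      omega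
    have := hHl ⟨(i : ℕ) - n, by omega⟩ ⟨(j : ℕ) - n, by omega⟩
      (by rw [Fin.lt_def]; simp only; omega)
    rwa [hH, Matrix.submatrix_apply, e i hi, e j hj] at this
end

section
/- Let p be a prime and let Q₀ ∈ ℤ_p ∖ {0}. Then every (SL_n × SL_{n+1})(ℤ_p)-orbit on {(A,B) ∈ W_N^top(ℤ_p) : λ(A,B) = Q₀} contains an element of W_N^{top,0}(ℤ_p). -/
open Matrix MvPolynomial

/-- Over a valuation ring, a unimodular matrix moves any vector onto a given coordinate axis. -/
theorem exists_det_one_mulVec_eq_single {R ι : Type*} [CommRing R] [IsDomain R] [ValuationRing R]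
    [Fintype ι] [DecidableEq ι] (v : ι → R) (k : ι) :
    ∃ (g : Matrix ι ι R) (d : R), g.det = 1 ∧ g *ᵥ v = Pi.single k d := by
  have key : ∀ u : ι → R, (∀ i, u k ∣ u i) →
      ∃ g : Matrix ι ι R, g.det = 1 ∧ g *ᵥ u = Pi.single k (u k) := by
    intro u hu
    choose c hc using hu
    refine ⟨1 + replicateCol Unit (fun i => if i = k then 0 else -c i) *
      replicateRow Unit (Pi.single k (1 : R)), ?_, ?_⟩
    · rw [det_one_add_replicateCol_mul_replicateRow]
      simp
    · ext i
      rw [← vecMulVec_eq, add_mulVec, one_mulVec, vecMulVec_mulVec]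
      by_cases h : i = k
      · subst h; simp
      · simp [h, hc i, mul_comm]
  obtain ⟨m, hm⟩ : ∃ m, ∀ i, v m ∣ v i := by
    have : Nonempty ι := ⟨k⟩
    have : IsTrans R (fun a b => b ∣ a) := ⟨fun _ _ _ h₁ h₂ => h₂.trans h₁⟩
    refine Directed.finite_le (r := fun a b : R => b ∣ a) (f := v) (fun i j => ?_) id
    rcases ValuationRing.dvd_total (v i) (v j) with h | h
    · exact ⟨i, dvd_rfl, h⟩
    · exact ⟨j, h, dvd_rfl⟩
  by_cases hmk : m = k
  · subst hmk
    obtain ⟨g, hg, hgv⟩ := key v hm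
    exact ⟨g, _, hg, hgv⟩
  · obtain ⟨c, hc⟩ := hm k
    have hu : ∀ i, (transvection k m (1 - c) *ᵥ v) i = if i = k then v m else v i := by
      intro i
      rw [transvection, add_mulVec, one_mulVec, single_mulVec]
      by_cases h : i = k
      · subst h
        simp only [Pi.add_apply, Function.update_self, if_true, hc]
        ring
      · simp [h]
    obtain ⟨g, hg, hgv⟩ := key (transvection k m (1 - c) *ᵥ v) (fun i => by
      rw [hu, hu, if_pos rfl]
      split_ifs
      exacts [dvd_rfl, hm i])
    refine ⟨g * transvection k m (1 - c), _, ?_, (mulVec_mulVec _ _ _).symm.trans hgv⟩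
    rw [det_mul, hg, det_transvection_of_ne _ _ (Ne.symm hmk), one_mul]

/-- Over a valuation ring, unimodular column operations kill a column of a matrix with one more
column than rows. -/
theorem exists_det_one_mul_transpose_apply_zero {R : Type*} [CommRing R] [IsDomain R]
    [ValuationRing R] {n : ℕ} (A : Matrix (Fin n) (Fin (n + 1)) R) :
    ∃ h : Matrix (Fin (n + 1)) (Fin (n + 1)) R, h.det = 1 ∧ ∀ i, (A * hᵀ) i 0 = 0 := by
  obtain ⟨u, hu0, hu⟩ : ∃ u : Fin (n + 1) → R, u ≠ 0 ∧ A *ᵥ u = 0 := by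
    have hdet : (of (Fin.cons 0 fun i => A i) : Matrix (Fin (n + 1)) (Fin (n + 1)) R).det = 0 :=
      det_eq_zero_of_row_eq_zero 0 fun j => by simp
    obtain ⟨u, hu0, hu⟩ := exists_mulVec_eq_zero_iff.mpr hdet
    exact ⟨u, hu0, funext fun i => by simpa [mulVec] using congrFun hu i.succ⟩
  obtain ⟨g, d, hg, hgu⟩ := exists_det_one_mulVec_eq_single u 0
  have hadj : g.adjugate * g = 1 := by rw [adjugate_mul, hg, one_smul]
  have hu' : u = d • g.adjugate.col 0 := by
    rw [← one_mulVec u, ← hadj, ← mulVec_mulVec, hgu, mulVec_single]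
    ext i
    simp [mul_comm]
  have hd : d ≠ 0 := by
    rintro rfl
    exact hu0 (by rw [hu', zero_smul])
  refine ⟨g.adjugateᵀ, by rw [det_transpose, det_adjugate, hg, one_pow], fun i => ?_⟩
  rw [hu', mulVec_smul] at hu
  have := congrFun hu i
  simp only [Pi.smul_apply, smul_eq_mul, Pi.zero_apply, mul_eq_zero, hd, false_or] at this
  rw [transpose_transpose]
  exact this

/-- Over a valuation ring, a pencil of `n × (n+1)` matrices can be brought by unimodular row and
column operations to a shape vanishing above the antidiagonals. -/
theorem exists_det_one_antitriangular {R : Type*} [CommRing R] [IsDomain R] [ValuationRing R] :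
    ∀ (n : ℕ) (A B : Matrix (Fin n) (Fin (n + 1)) R),
      ∃ (g : Matrix (Fin n) (Fin n) R) (h : Matrix (Fin (n + 1)) (Fin (n + 1)) R),
        g.det = 1 ∧ h.det = 1 ∧ ∀ (i : Fin n) (j : Fin (n + 1)),
          ((i : ℕ) + j < n → (g * A * hᵀ) i j = 0) ∧
          ((i : ℕ) + j + 1 < n → (g * B * hᵀ) i j = 0)
  | 0, _, _ => ⟨1, 1, det_one, det_one, fun i => i.elim0⟩
  | n + 1, A, B => by
    obtain ⟨h₀, hh₀, hA⟩ := exists_det_one_mul_transpose_apply_zero A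
    obtain ⟨g₀, d, hg₀, hB⟩ :=
      exists_det_one_mulVec_eq_single ((B * h₀ᵀ).col 0) (Fin.last n)
    obtain ⟨g', h', hg', hh', H⟩ := exists_det_one_antitriangular n
      ((g₀ * A * h₀ᵀ).submatrix Fin.castSucc Fin.succ)
      ((g₀ * B * h₀ᵀ).submatrix Fin.castSucc Fin.succ)
    have hA₁ : ∀ i, (g₀ * A * h₀ᵀ) i 0 = 0 := fun i => by
      rw [Matrix.mul_assoc, Matrix.mul_apply]
      exact Finset.sum_eq_zero fun k _ => by rw [hA k, mul_zero]
    have hB₁ : ∀ i : Fin n, (g₀ * B * h₀ᵀ) i.castSucc 0 = 0 := fun i => by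
      have := congrFun hB i.castSucc
      rw [Pi.single_eq_of_ne (Fin.castSucc_lt_last i).ne] at this
      rw [Matrix.mul_assoc]
      exact this
    set g₁ : Matrix (Fin (n + 1)) (Fin (n + 1)) R :=
      of (Fin.snoc (fun i => Fin.snoc (g' i) 0) (Pi.single (Fin.last n) 1)) with hg₁
    set h₁ : Matrix (Fin (n + 2)) (Fin (n + 2)) R :=
      of (Fin.cons (Pi.single 0 1) (fun i => Fin.cons 0 (h' i))) with hh₁
    have hg₁det : g₁.det = 1 := by
      rw [det_succ_row _ (Fin.last n), Finset.sum_eq_single (Fin.last n)]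
      · have : g₁.submatrix (Fin.last n).succAbove (Fin.last n).succAbove = g' := by
          ext i j
          simp [hg₁]
        rw [this, hg']
        simp [hg₁, ← two_mul]
      · intro j _ hj
        simp [hg₁, hj]
      · simp
    have hh₁det : h₁.det = 1 := by
      rw [det_succ_row_zero, Finset.sum_eq_single 0]
      · have : h₁.submatrix Fin.succ (Fin.succAbove 0) = h' := by
          ext i j
          simp [hh₁]
        rw [this, hh']
        simp [hh₁]
      · intro j _ hj
        simp [hh₁, hj]
      · simp
    have entry_zero : ∀ (M : Matrix (Fin (n + 1)) (Fin (n + 2)) R) i,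
        (∀ i, M (Fin.castSucc i) 0 = 0) → (g₁ * M * h₁ᵀ) (Fin.castSucc i) 0 = 0 := by
      intro M i hM
      simp [Matrix.mul_apply, Fin.sum_univ_succ (n := n + 1), Fin.sum_univ_castSucc (n := n),
        hg₁, hh₁, hM]
    have entry_zero_last : ∀ (M : Matrix (Fin (n + 1)) (Fin (n + 2)) R),
        M (Fin.last n) 0 = 0 → (g₁ * M * h₁ᵀ) (Fin.last n) 0 = 0 := by
      intro M hM
      simp [Matrix.mul_apply, Fin.sum_univ_succ (n := n + 1), Fin.sum_univ_castSucc (n := n),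
        hg₁, hh₁, hM]
    have entry_succ : ∀ (M : Matrix (Fin (n + 1)) (Fin (n + 2)) R) i j,
        (g₁ * M * h₁ᵀ) (Fin.castSucc i) (Fin.succ j) =
          (g' * M.submatrix Fin.castSucc Fin.succ * h'ᵀ) i j := by
      intro M i j
      simp [Matrix.mul_apply, Fin.sum_univ_succ (n := n + 1), Fin.sum_univ_castSucc (n := n),
        hg₁, hh₁]
    have assoc : ∀ M : Matrix (Fin (n + 1)) (Fin (n + 2)) R,
        g₁ * g₀ * M * (h₁ * h₀)ᵀ = g₁ * (g₀ * M * h₀ᵀ) * h₁ᵀ := fun M => by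
      simp only [transpose_mul, Matrix.mul_assoc]
    refine ⟨g₁ * g₀, h₁ * h₀, by rw [det_mul, hg₁det, hg₀, one_mul],
      by rw [det_mul, hh₁det, hh₀, one_mul], fun i j => ?_⟩
    rw [assoc, assoc]
    refine Fin.lastCases ?_ (fun i => ?_) i <;> refine Fin.cases ?_ (fun j => ?_) j
    · exact ⟨fun _ => entry_zero_last _ (hA₁ _), fun h => by simp at h⟩
    · exact ⟨fun h => by simp at h, fun h => by simp at h⟩
    · exact ⟨fun _ => entry_zero _ _ fun _ => hA₁ _, fun _ => entry_zero _ _ hB₁⟩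
    · rw [entry_succ, entry_succ]
      simp only [Fin.val_castSucc, Fin.val_succ]
      exact ⟨fun h => (H i j).1 (by omega), fun h => (H i j).2 (by omega)⟩

/-- The splitting of the `2n+1` indices into the first `n` and the last `n+1`. -/
def blockEquiv (n : ℕ) : Fin n ⊕ Fin (n + 1) ≃ Fin (2 * n + 1) :=
  finSumFinEquiv.trans (finCongr (by omega))

theorem blockEquiv_inl (n : ℕ) (i : Fin n) : blockEquiv n (Sum.inl i) = rowIdx n i := rfl

theorem blockEquiv_inr (n : ℕ) (j : Fin (n + 1)) : blockEquiv n (Sum.inr j) = colIdx n j := rfl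

theorem val_rowIdx (n : ℕ) (i : Fin n) : (rowIdx n i : ℕ) = i := rfl

theorem val_colIdx (n : ℕ) (j : Fin (n + 1)) : (colIdx n j : ℕ) = n + j := rfl

theorem forall_index_iff {n : ℕ} {P : Fin (2 * n + 1) → Prop} :
    (∀ i, P i) ↔ (∀ i, P (rowIdx n i)) ∧ ∀ j, P (colIdx n j) := by
  rw [← (blockEquiv n).forall_congr_right, Sum.forall]
  rfl

/-- A block-diagonal matrix acts on a symmetric matrix with vanishing diagonal blocks through its
top-right block. -/
theorem reindex_fromBlocks_mul_mul_transpose {R : Type*} [CommRing R] {n : ℕ}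
    (g : Matrix (Fin n) (Fin n) R) (h : Matrix (Fin (n + 1)) (Fin (n + 1)) R)
    (M : Matrix (Fin (2 * n + 1)) (Fin (2 * n + 1)) R) (hM : M.IsSymm)
    (hrow : ∀ i j, M (rowIdx n i) (rowIdx n j) = 0)
    (hcol : ∀ i j, M (colIdx n i) (colIdx n j) = 0) :
    reindex (blockEquiv n) (blockEquiv n) (fromBlocks g 0 0 h) * M *
        (reindex (blockEquiv n) (blockEquiv n) (fromBlocks g 0 0 h))ᵀ =
      reindex (blockEquiv n) (blockEquiv n)
        (fromBlocks 0 (g * M.submatrix (rowIdx n) (colIdx n) * hᵀ)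
          (g * M.submatrix (rowIdx n) (colIdx n) * hᵀ)ᵀ 0) := by
  have hM' : M = reindex (blockEquiv n) (blockEquiv n)
      (fromBlocks 0 (M.submatrix (rowIdx n) (colIdx n))
        (M.submatrix (rowIdx n) (colIdx n))ᵀ 0) := by
    rw [← Equiv.symm_apply_eq]
    ext (i | i) (j | j)
    · exact hrow i j
    · rfl
    · exact hM.apply _ _
    · exact hcol i j
  conv_lhs => rw [hM']
  simp only [reindex_apply, transpose_submatrix, submatrix_mul_equiv, fromBlocks_transpose,
    fromBlocks_multiply]
  simp [Matrix.mul_assoc]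

/-- **Every `(SL_n × SL_{n+1})(ℤ_p)`-orbit on a `λ`-level set meets `W_N^{top,0}(ℤ_p)`.**
Let `p` be a prime and `Q₀ ∈ ℤ_p ∖ {0}`.  Then every `(SL_n × SL_{n+1})(ℤ_p)`-orbit on
`{(A,B) ∈ W_N^top(ℤ_p) : λ(A,B) = Q₀}` contains an element of `W_N^{top,0}(ℤ_p)`. -/
theorem orbit_meets_Wtop0 (n : ℕ) (hn : 1 ≤ n) (p : ℕ) [Fact p.Prime]
    (Q₀ : ℤ_[p]) (hQ₀ : Q₀ ≠ 0) (w : MPair n ℤ_[p])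
    (hw : Wtopmem n w) (hl : lambdaInv n w = Q₀) :
    ∃ g : Matrix (Fin (2*n+1)) (Fin (2*n+1)) ℤ_[p],
      SLnn1mem n g ∧ Wtop0mem n (actPair g w) := by
  obtain ⟨g, h, hg, hh, H⟩ := exists_det_one_antitriangular n
    (w.1.submatrix (rowIdx n) (colIdx n)) (w.2.submatrix (rowIdx n) (colIdx n))
  have hrow : ∀ i j, w.1 (rowIdx n i) (rowIdx n j) = 0 ∧ w.2 (rowIdx n i) (rowIdx n j) = 0 :=
    fun i j => hw.2 _ _ (Or.inl ⟨i.2, j.2⟩)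
  have hcol : ∀ i j, w.1 (colIdx n i) (colIdx n j) = 0 ∧ w.2 (colIdx n i) (colIdx n j) = 0 :=
    fun i j => hw.2 _ _ (Or.inr ⟨Nat.le_add_right n i, Nat.le_add_right n j⟩)
  have hsymm (M : Matrix (Fin (2*n+1)) (Fin (2*n+1)) ℤ_[p]) (hM : M.IsSymm)
      (k : Matrix (Fin (2*n+1)) (Fin (2*n+1)) ℤ_[p]) : (k * M * kᵀ).IsSymm := by
    simp only [IsSymm, transpose_mul, transpose_transpose, hM.eq, Matrix.mul_assoc]
  have h₁ := reindex_fromBlocks_mul_mul_transpose g h w.1 hw.1.1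
    (fun i j => (hrow i j).1) (fun i j => (hcol i j).1)
  have h₂ := reindex_fromBlocks_mul_mul_transpose g h w.2 hw.1.2
    (fun i j => (hrow i j).2) (fun i j => (hcol i j).2)
  refine ⟨reindex (blockEquiv n) (blockEquiv n) (fromBlocks g 0 0 h), ⟨?_, ?_, ?_⟩,
    ⟨⟨hsymm _ hw.1.1 _, hsymm _ hw.1.2 _⟩, ?_⟩, ?_⟩
  · simp only [forall_index_iff, val_rowIdx, val_colIdx]
    simp only [← blockEquiv_inl, ← blockEquiv_inr]
    refine ⟨fun i => ⟨fun j hij => ?_, fun j _ => by simp⟩,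
      fun i => ⟨fun j _ => by simp, fun j hij => ?_⟩⟩ <;> omega
  · rw [← hg]
    congr 1
    ext i j
    simp [← blockEquiv_inl]
  · rw [← hh]
    congr 1
    ext i j
    simp [← blockEquiv_inr]
  · simp only [actPair, h₁, h₂]
    simp only [forall_index_iff, val_rowIdx, val_colIdx]
    simp only [← blockEquiv_inl, ← blockEquiv_inr]
    refine ⟨fun i => ⟨fun j _ => by simp, fun j hij => ?_⟩,
      fun i => ⟨fun j hij => ?_, fun j _ => by simp⟩⟩ <;> omega
  · simp only [actPair, h₁, h₂]
    simp only [forall_index_iff, val_rowIdx, val_colIdx]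
    simp only [← blockEquiv_inl, ← blockEquiv_inr, reindex_apply, submatrix_apply,
      Equiv.symm_apply_apply, fromBlocks_apply₁₁, fromBlocks_apply₁₂, fromBlocks_apply₂₁,
      fromBlocks_apply₂₂, transpose_apply, Matrix.zero_apply, implies_true, and_true, true_and]
    exact ⟨fun i j => ⟨fun hij => (H i j).1 (by omega), fun hij => (H i j).2 (by omega)⟩,
      fun j i => ⟨fun hij => (H i j).1 (by omega), fun hij => (H i j).2 (by omega)⟩⟩
end

section
/- Let G be a group, let G₁, G₂ ≤ G be subgroups, and let Q₁, Z₁ ≤ G₁ and Q₂, Z₂ ≤ G₂ be subgroups such that G₁ = Q₁Z₁ and G₂ = Q₂Z₂ as setwise products. Suppose that every element of G can be written as g₁g₂ with g₁ ∈ G₁ and g₂ ∈ G₂, and that Z₁Q₂ ⊆ Q₂G₁ (as subsets of G). Then for any subgroups Q, Z ≤ G with Q₁ ∪ Q₂ ⊆ Q and Z₁ ∪ Z₂ ⊆ Z, we have G = QZ, i.e., every element of G can be written as qz with q ∈ Q and z ∈ Z. -/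
/-- **Abstract class number one lemma.**
Let `G` be a group with subgroups `G₁, G₂`, and subgroups `Q₁, Z₁ ≤ G₁` and `Q₂, Z₂ ≤ G₂`
with `G₁ = Q₁Z₁` and `G₂ = Q₂Z₂` as setwise products.  Suppose `G = G₁G₂` setwise and
`Z₁Q₂ ⊆ Q₂G₁`.  Then for any subgroups `Q, Z ≤ G` with `Q₁ ∪ Q₂ ⊆ Q` and `Z₁ ∪ Z₂ ⊆ Z`,
we have `G = QZ`. -/
theorem frobenius_product_class_number_one {G : Type*} [Group G]
    (G₁ G₂ Q₁ Z₁ Q₂ Z₂ : Subgroup G)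
    (hQ₁G₁ : Q₁ ≤ G₁) (hZ₁G₁ : Z₁ ≤ G₁) (hQ₂G₂ : Q₂ ≤ G₂) (hZ₂G₂ : Z₂ ≤ G₂)
    (hG₁ : ∀ g ∈ G₁, ∃ q ∈ Q₁, ∃ z ∈ Z₁, g = q * z)
    (hG₂ : ∀ g ∈ G₂, ∃ q ∈ Q₂, ∃ z ∈ Z₂, g = q * z)
    (hG : ∀ g : G, ∃ g₁ ∈ G₁, ∃ g₂ ∈ G₂, g = g₁ * g₂)
    (hswap : ∀ z ∈ Z₁, ∀ q ∈ Q₂, ∃ q' ∈ Q₂, ∃ g ∈ G₁, z * q = q' * g)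
    (Q Z : Subgroup G) (hQ₁ : Q₁ ≤ Q) (hQ₂ : Q₂ ≤ Q) (hZ₁ : Z₁ ≤ Z) (hZ₂ : Z₂ ≤ Z) :
    ∀ g : G, ∃ q ∈ Q, ∃ z ∈ Z, g = q * z := by
  intro g
  obtain ⟨g₁, hg₁, g₂, hg₂, rfl⟩ := hG g
  obtain ⟨q₁, hq₁, z₁, hz₁, rfl⟩ := hG₁ g₁ hg₁
  obtain ⟨q₂, hq₂, z₂, hz₂, rfl⟩ := hG₂ g₂ hg₂
  obtain ⟨q, hq, h, hh, hzq⟩ := hswap z₁ hz₁ q₂ hq₂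
  obtain ⟨a, ha, b, hb, rfl⟩ := hG₁ h hh
  refine ⟨q₁ * q * a, Q.mul_mem (Q.mul_mem (hQ₁ hq₁) (hQ₂ hq)) (hQ₁ ha),
    b * z₂, Z.mul_mem (hZ₁ hb) (hZ₂ hz₂), ?_⟩
  calc q₁ * z₁ * (q₂ * z₂) = q₁ * (z₁ * q₂) * z₂ := by group
    _ = q₁ * q * a * (b * z₂) := by rw [hzq]; group
end
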